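/- arXiv:1909.06565 — 2 statements merged into one kernel-verified Lean document; each statement's English description precedes it below -/
import Mathlib

section
/- For all reals k, l > 0, the limit as ε → 0⁺ of [ ∫_ε^{l−ε} Υ_δ(x) dx − (1/k²)·H₀⁽¹⁾(kε) ] exists and equals −(2/(k⁴ l²))·[ k·l·H₁⁽¹⁾(kl) + 2i/π ]. -/
open MeasureTheory Set Filter Topology Real intervalIntegral

/-- Bessel function of the first kind `J_n(x)` (integral representation). -/
noncomputable def besselJ (n : ℕ) (x : ℝ) : ℝ :=
  (1 / π) * ∫ τ in (0:ℝ)..π, Real.cos (n * τ - x * Real.sin τ)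

/-- Bessel function of the second kind `Y_n(x)` (integral representation). -/
noncomputable def besselY (n : ℕ) (x : ℝ) : ℝ :=
  (1 / π) * (∫ τ in (0:ℝ)..π, Real.sin (x * Real.sin τ - n * τ))
    - (1 / π) * ∫ t in Set.Ioi (0:ℝ),
        (Real.exp (n * t) + (-1 : ℝ) ^ n * Real.exp (-(n * t))) * Real.exp (-x * Real.sinh t)

/-- Hankel function of the first kind `H_n^{(1)}(x) = J_n(x) + i Y_n(x)`. -/
noncomputable def hankelH1 (n : ℕ) (x : ℝ) : ℂ :=
  (besselJ n x : ℂ) + Complex.I * (besselY n x : ℂ)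

/-- Struve function `𝐇₀(x)`. -/
noncomputable def struveH0 (x : ℝ) : ℝ :=
  (2 / π) * ∫ t in (0:ℝ)..1, Real.sin (x * t) / Real.sqrt (1 - t ^ 2)

/-- Struve function `𝐇₁(x)`. -/
noncomputable def struveH1 (x : ℝ) : ℝ :=
  (2 * x / π) * ∫ t in (0:ℝ)..1, Real.sqrt (1 - t ^ 2) * Real.sin (x * t)

/-- Struve function `𝐇₋₁(x) = 2/π − 𝐇₁(x)`. -/
noncomputable def struveHm1 (x : ℝ) : ℝ := 2 / π - struveH1 x

/-- `Υ_α(x) = (1/k)·[H₁⁽¹⁾(kx) + H₁⁽¹⁾(k(l−x))]`. -/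
noncomputable def upsAlpha (k l x : ℝ) : ℂ :=
  ((1 / k : ℝ) : ℂ) * (hankelH1 1 (k * x) + hankelH1 1 (k * (l - x)))

/-- `Υ_β(x) = (x/l)·Υ_α(x)`. -/
noncomputable def upsBeta (k l x : ℝ) : ℂ := ((x / l : ℝ) : ℂ) * upsAlpha k l x

/-- `Υ_γ(x) = Υ_β(x) + (1/(k²l))·[k(l−x)·H₁⁽¹⁾(k(l−x)) − kx·H₁⁽¹⁾(kx)
  + H₀⁽¹⁾(k(l−x)) − H₀⁽¹⁾(kx)]`. -/
noncomputable def upsGamma (k l x : ℝ) : ℂ :=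
  upsBeta k l x + ((1 / (k ^ 2 * l) : ℝ) : ℂ) *
    (((k * (l - x) : ℝ) : ℂ) * hankelH1 1 (k * (l - x))
      - ((k * x : ℝ) : ℂ) * hankelH1 1 (k * x)
      + hankelH1 0 (k * (l - x)) - hankelH1 0 (k * x))

/-- `Υ_δ(x) = (x/l)·Υ_γ(x)`. -/
noncomputable def upsDelta (k l x : ℝ) : ℂ := ((x / l : ℝ) : ℂ) * upsGamma k l x


noncomputable def auxC (n : ℕ) (x : ℝ) : ℝ := ∫ τ in (0:ℝ)..π, sin τ ^ n * cos (x * sin τ)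
noncomputable def auxS (n : ℕ) (x : ℝ) : ℝ := ∫ τ in (0:ℝ)..π, sin τ ^ n * sin (x * sin τ)
noncomputable def auxE (n : ℕ) (x : ℝ) : ℝ :=
  ∫ t in Set.Ioi (0:ℝ), sinh t ^ n * exp (-x * sinh t)

lemma auxC_deriv (n : ℕ) (x : ℝ) : HasDerivAt (auxC n) (-auxS (n+1) x) x := by
  have := intervalIntegral.hasDerivAt_integral_of_dominated_loc_of_deriv_le (𝕜 := ℝ)
    (μ := volume) (a := 0) (b := π) (s := univ) (x₀ := x) (bound := fun _ => 1)
    (F := fun x τ => sin τ ^ n * cos (x * sin τ))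
    (F' := fun x τ => -(sin τ ^ (n+1) * sin (x * sin τ))) univ_mem
    (Eventually.of_forall fun y => (by fun_prop : Continuous _).aestronglyMeasurable)
    ((by fun_prop : Continuous _).intervalIntegrable _ _)
    (by fun_prop : Continuous _).aestronglyMeasurable
    (Eventually.of_forall fun t _ y _ => by
      rw [norm_neg, norm_mul, norm_pow]
      exact mul_le_one₀ (pow_le_one₀ (norm_nonneg _) (abs_sin_le_one _)) (norm_nonneg _)
        (abs_sin_le_one _))
    (continuous_const.intervalIntegrable _ _)
    (Eventually.of_forall fun t _ y _ => by
      have h := (((hasDerivAt_id y).mul_const (sin t)).cos).const_mul (sin t ^ n)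
      refine h.congr_deriv ?_
      simp only [id]; ring)
  have h2 := this.2
  rw [intervalIntegral.integral_neg] at h2
  exact h2

lemma auxS_deriv (n : ℕ) (x : ℝ) : HasDerivAt (auxS n) (auxC (n+1) x) x := by
  have := intervalIntegral.hasDerivAt_integral_of_dominated_loc_of_deriv_le (𝕜 := ℝ)
    (μ := volume) (a := 0) (b := π) (s := univ) (x₀ := x) (bound := fun _ => 1)
    (F := fun x τ => sin τ ^ n * sin (x * sin τ))
    (F' := fun x τ => (sin τ ^ (n+1) * cos (x * sin τ))) univ_mem
    (Eventually.of_forall fun y => (by fun_prop : Continuous _).aestronglyMeasurable)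
    ((by fun_prop : Continuous _).intervalIntegrable _ _)
    (by fun_prop : Continuous _).aestronglyMeasurable
    (Eventually.of_forall fun t _ y _ => by
      rw [norm_mul, norm_pow]
      exact mul_le_one₀ (pow_le_one₀ (norm_nonneg _) (abs_sin_le_one _)) (norm_nonneg _)
        (abs_cos_le_one _))
    (continuous_const.intervalIntegrable _ _)
    (Eventually.of_forall fun t _ y _ => by
      have h := (((hasDerivAt_id y).mul_const (sin t)).sin).const_mul (sin t ^ n)
      refine h.congr_deriv ?_
      simp only [id]; ring)
  exact this.2

lemma exp_le_sinh {t : ℝ} (ht : 0 ≤ t) : exp t ≤ 1 + 2 * sinh t := by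
  have : exp (-t) ≤ 1 := by simpa using ht
  rw [sinh_eq]; linarith

lemma key_bound {a : ℝ} (ha : 0 < a) {t : ℝ} (ht : 0 ≤ t) :
    exp (2 * t) * exp (-a * sinh t) ≤ (48 / a ^ 3 * exp (a / 2)) * exp (-t) := by
  have hs : 0 ≤ sinh t := sinh_nonneg_iff.2 ht
  have h1 : exp t ^ 3 ≤ (1 + 2 * sinh t) ^ 3 :=
    pow_le_pow_left₀ (exp_pos _).le (exp_le_sinh ht) 3
  have h2 := Real.pow_div_factorial_le_exp (a / 2 * (1 + 2 * sinh t)) (by positivity) 3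
  have h3 : exp (a / 2 * (1 + 2 * sinh t)) = exp (a/2) * exp (a * sinh t) := by
    rw [← exp_add]; ring_nf
  rw [h3] at h2
  have h4 : (1 + 2 * sinh t) ^ 3 ≤ 48 / a ^ 3 * (exp (a/2) * exp (a * sinh t)) := by
    rw [div_mul_eq_mul_div, le_div_iff₀ (by positivity)]
    norm_num [Nat.factorial] at h2
    nlinarith
  have h5 := h1.trans h4
  have e1 : exp (2 * t) = exp t ^ 3 * exp (-t) := by
    rw [← exp_nat_mul, ← exp_add]; push_cast; ring_nf
  have e2 : exp (-a * sinh t) * exp (a * sinh t) = 1 := by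
    rw [← exp_add]; ring_nf; simp
  calc exp (2 * t) * exp (-a * sinh t) = exp t ^ 3 * (exp (-t) * exp (-a * sinh t)) := by
        rw [e1]; ring
    _ ≤ (48 / a ^ 3 * (exp (a/2) * exp (a * sinh t))) * (exp (-t) * exp (-a * sinh t)) := by
        gcongr
    _ = (48 / a ^ 3 * exp (a/2)) * exp (-t) * (exp (-a * sinh t) * exp (a * sinh t)) := by ring
    _ = _ := by rw [e2]; ring

lemma exp_neg_int : IntegrableOn (fun t : ℝ => exp (-t)) (Ioi 0) := integrableOn_exp_neg_Ioi 0

lemma int_gen {a : ℝ} (ha : 0 < a) {g : ℝ → ℝ} (hg : Continuous g)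
    (hb : ∀ t, 0 ≤ t → |g t| ≤ exp (2 * t)) :
    IntegrableOn (fun t => g t * exp (-a * sinh t)) (Ioi 0) := by
  refine Integrable.mono' (exp_neg_int.const_mul (48 / a ^ 3 * exp (a / 2)))
    (by have := Real.continuous_sinh; fun_prop : Continuous _).aestronglyMeasurable ?_
  filter_upwards [ae_restrict_mem measurableSet_Ioi] with t ht
  have ht : 0 ≤ t := le_of_lt ht
  refine le_trans ?_ (key_bound ha ht)
  rw [norm_mul, Real.norm_eq_abs, Real.norm_eq_abs, abs_exp]
  have := hb t ht
  gcongr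

lemma sinh_le_exp (t : ℝ) : sinh t ≤ exp t := by
  have := exp_pos (-t); have := exp_pos t
  rw [sinh_eq]; linarith

lemma cosh_le_exp {t : ℝ} (ht : 0 ≤ t) : cosh t ≤ exp t := by
  have : exp (-t) ≤ exp t := by simpa using (by linarith)
  rw [cosh_eq]; linarith

lemma pow_le_exp2 {t u : ℝ} (ht : 0 ≤ t) (hu : 0 ≤ u) (h : u ≤ exp t) {n : ℕ} (hn : n ≤ 2) :
    |u ^ n| ≤ exp (2 * t) := by
  rw [abs_of_nonneg (by positivity)]
  calc u ^ n ≤ exp t ^ n := by gcongr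
    _ ≤ exp t ^ 2 := pow_le_pow_right₀ (by simpa using ht) hn
    _ = _ := by rw [← exp_nat_mul]; norm_num

lemma sinh_int {a : ℝ} (ha : 0 < a) {n : ℕ} (hn : n ≤ 2) :
    IntegrableOn (fun t => sinh t ^ n * exp (-a * sinh t)) (Ioi 0) :=
  int_gen ha (by have := Real.continuous_sinh; fun_prop)
    fun _ ht => pow_le_exp2 ht (sinh_nonneg_iff.2 ht) (sinh_le_exp _) hn

lemma cosh_int {a : ℝ} (ha : 0 < a) {n : ℕ} (hn : n ≤ 2) :
    IntegrableOn (fun t => cosh t ^ n * exp (-a * sinh t)) (Ioi 0) :=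
  int_gen ha (by have := Real.continuous_cosh; fun_prop)
    fun _ ht => pow_le_exp2 ht (cosh_pos _).le (cosh_le_exp ht) hn

lemma auxE_deriv {n : ℕ} (hn : n ≤ 1) {x : ℝ} (hx : 0 < x) :
    HasDerivAt (auxE n) (-auxE (n+1) x) x := by
  have := _root_.hasDerivAt_integral_of_dominated_loc_of_deriv_le (𝕜 := ℝ)
    (μ := volume.restrict (Ioi 0)) (s := Ioi (x/2)) (x₀ := x)
    (bound := fun t => sinh t ^ (n+1) * exp (-(x/2) * sinh t))
    (F := fun x t => sinh t ^ n * exp (-x * sinh t))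
    (F' := fun x t => -(sinh t ^ (n+1) * exp (-x * sinh t))) (Ioi_mem_nhds (by linarith))
    (Eventually.of_forall fun y =>
      (by have := Real.continuous_sinh; fun_prop : Continuous _).aestronglyMeasurable)
    (sinh_int hx (by omega))
    (by have := Real.continuous_sinh; fun_prop : Continuous _).aestronglyMeasurable
    (by
      filter_upwards [ae_restrict_mem measurableSet_Ioi] with t ht y hy
      have hs : 0 ≤ sinh t := sinh_nonneg_iff.2 (le_of_lt ht)
      have hy : x / 2 < y := hy
      rw [norm_neg, Real.norm_eq_abs, abs_of_nonneg (by positivity)]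
      gcongr)
    (sinh_int (by linarith) (by omega))
    (Eventually.of_forall fun t y _ => by
      have h := ((((hasDerivAt_id y).neg).mul_const (sinh t)).exp).const_mul (sinh t ^ n)
      refine h.congr_deriv ?_
      simp only [id, Pi.neg_apply]; ring)
  have h2 := this.2
  rw [MeasureTheory.integral_neg] at h2
  exact h2

lemma partsC (x : ℝ) : x * (auxC 0 x - auxC 2 x) = auxS 1 x := by
  have h : ∫ τ in (0:ℝ)..π, (x * (sin τ ^ 0 * cos (x * sin τ) - sin τ ^ 2 * cos (x * sin τ))
      - sin τ ^ 1 * sin (x * sin τ)) = 0 := by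
    rw [integral_eq_sub_of_hasDerivAt (f := fun τ => cos τ * sin (x * sin τ))]
    · simp
    · intro t _
      have h := (hasDerivAt_cos t).mul (((hasDerivAt_sin t).const_mul x).sin)
      refine h.congr_deriv ?_
      have := sin_sq_add_cos_sq t
      linear_combination (x * cos (x * sin t)) * this
    · exact (by fun_prop : Continuous _).intervalIntegrable _ _
  rw [integral_sub ((by fun_prop : Continuous _).intervalIntegrable _ _)
    ((by fun_prop : Continuous _).intervalIntegrable _ _), intervalIntegral.integral_const_mul,
    integral_sub ((by fun_prop : Continuous _).intervalIntegrable _ _)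
    ((by fun_prop : Continuous _).intervalIntegrable _ _)] at h
  unfold auxC auxS
  linarith

lemma partsS (x : ℝ) : x * (auxS 0 x - auxS 2 x) = 2 - auxC 1 x := by
  have h : ∫ τ in (0:ℝ)..π, (x * (sin τ ^ 0 * sin (x * sin τ) - sin τ ^ 2 * sin (x * sin τ))
      + sin τ ^ 1 * cos (x * sin τ)) = 2 := by
    rw [integral_eq_sub_of_hasDerivAt (f := fun τ => -(cos τ * cos (x * sin τ)))]
    · simp; norm_num
    · intro t _
      have h := ((hasDerivAt_cos t).mul (((hasDerivAt_sin t).const_mul x).cos)).neg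
      refine h.congr_deriv ?_
      have := sin_sq_add_cos_sq t
      linear_combination (x * sin (x * sin t)) * this
    · exact (by fun_prop : Continuous _).intervalIntegrable _ _
  rw [integral_add ((by fun_prop : Continuous _).intervalIntegrable _ _)
    ((by fun_prop : Continuous _).intervalIntegrable _ _), intervalIntegral.integral_const_mul,
    integral_sub ((by fun_prop : Continuous _).intervalIntegrable _ _)
    ((by fun_prop : Continuous _).intervalIntegrable _ _)] at h
  unfold auxC auxS
  linarith

lemma tendsto_aux {x : ℝ} (hx : 0 < x) {g : ℝ → ℝ} (h : ∀ t, 0 ≤ t → |g t| ≤ exp (2 * t)) :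
    Tendsto (fun t => g t * exp (-x * sinh t)) atTop (𝓝 0) := by
  have h1 : Tendsto (fun t : ℝ => (48 / x ^ 3 * exp (x / 2)) * exp (-t)) atTop (𝓝 0) := by
    simpa using (tendsto_exp_neg_atTop_nhds_zero).const_mul (48 / x ^ 3 * exp (x / 2))
  refine squeeze_zero_norm' ?_ h1
  filter_upwards [eventually_ge_atTop 0] with t ht
  refine le_trans ?_ (key_bound hx ht)
  rw [norm_mul, Real.norm_eq_abs, Real.norm_eq_abs, abs_exp]
  have := h t ht
  gcongr

lemma partsE {x : ℝ} (hx : 0 < x) : x * (auxE 0 x + auxE 2 x) = 1 + auxE 1 x := by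
  have i0 := sinh_int hx (n := 0) (by norm_num)
  have i1 := sinh_int hx (n := 1) (by norm_num)
  have i2 := sinh_int hx (n := 2) (by norm_num)
  have h : ∫ t in Ioi (0:ℝ), (x * (sinh t ^ 0 * exp (-x * sinh t) + sinh t ^ 2 * exp (-x * sinh t))
      - sinh t ^ 1 * exp (-x * sinh t)) = 0 - (-(cosh 0 * exp (-x * sinh 0))) := by
    refine integral_Ioi_of_hasDerivAt_of_tendsto' (f := fun t => -(cosh t * exp (-x * sinh t)))
      (fun t _ => ?_) (((i0.add i2).const_mul x).sub i1) ?_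
    · have h := ((hasDerivAt_cosh t).mul (((hasDerivAt_sinh t).const_mul (-x)).exp)).neg
      refine h.congr_deriv ?_
      have := cosh_sq t
      linear_combination (x * exp (-x * sinh t)) * this
    · simpa using (tendsto_aux hx (g := cosh) fun t ht => by
        simpa using pow_le_exp2 ht (cosh_pos _).le (cosh_le_exp ht) (n := 1) (by norm_num)).neg
  have e : ∫ t in Ioi (0:ℝ), (x * (sinh t ^ 0 * exp (-x * sinh t) + sinh t ^ 2 * exp (-x * sinh t))
      - sinh t ^ 1 * exp (-x * sinh t)) = x * (auxE 0 x + auxE 2 x) - auxE 1 x := by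
    have j : Integrable (fun t => x * (sinh t ^ 0 * exp (-x * sinh t) +
        sinh t ^ 2 * exp (-x * sinh t))) (volume.restrict (Ioi 0)) := (i0.add i2).const_mul x
    rw [MeasureTheory.integral_sub j i1, MeasureTheory.integral_const_mul,
      MeasureTheory.integral_add i0 i2]
    rfl
  rw [e] at h
  simp at h
  linarith

lemma J0_eq (x : ℝ) : besselJ 0 x = auxC 0 x / π := by
  unfold besselJ auxC
  simp [div_eq_inv_mul]

lemma Y0_eq (x : ℝ) : besselY 0 x = (auxS 0 x - 2 * auxE 0 x) / π := by
  unfold besselY auxS auxE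
  simp only [Nat.cast_zero, zero_mul, sub_zero, pow_zero, neg_zero, exp_zero, one_mul,
    MeasureTheory.integral_const_mul]
  ring

lemma J1_eq {x : ℝ} (hx : 0 < x) : besselJ 1 x = auxS 1 x / π := by
  have h : ∫ τ in (0:ℝ)..π, (cos (x * sin τ) * cos τ) = 0 := by
    rw [integral_eq_sub_of_hasDerivAt (f := fun τ => sin (x * sin τ) / x)]
    · simp
    · intro t _
      have h := (((hasDerivAt_sin t).const_mul x).sin).div_const x
      refine h.congr_deriv ?_
      field_simp
    · exact (by fun_prop : Continuous _).intervalIntegrable _ _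
  have e : ∀ τ : ℝ, cos ((1:ℕ) * τ - x * sin τ)
      = cos (x * sin τ) * cos τ + sin τ ^ 1 * sin (x * sin τ) := by
    intro τ; rw [Nat.cast_one, one_mul, cos_sub]; ring
  unfold besselJ auxS
  simp_rw [e]
  rw [integral_add ((by fun_prop : Continuous _).intervalIntegrable _ _)
    ((by fun_prop : Continuous _).intervalIntegrable _ _), h]
  ring

lemma Y1_eq {x : ℝ} (hx : 0 < x) : besselY 1 x = (-auxC 1 x - 2 * auxE 1 x) / π := by
  have h : ∫ τ in (0:ℝ)..π, (sin (x * sin τ) * cos τ) = 0 := by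
    rw [integral_eq_sub_of_hasDerivAt (f := fun τ => -cos (x * sin τ) / x)]
    · simp
    · intro t _
      have h := (((hasDerivAt_sin t).const_mul x).cos).neg.div_const x
      refine h.congr_deriv ?_
      field_simp
    · exact (by fun_prop : Continuous _).intervalIntegrable _ _
  have e : ∀ τ : ℝ, sin (x * sin τ - (1:ℕ) * τ)
      = sin (x * sin τ) * cos τ - sin τ ^ 1 * cos (x * sin τ) := by
    intro τ; rw [Nat.cast_one, one_mul, sin_sub]; ring
  have e2 : ∀ t : ℝ, (exp ((1:ℕ) * t) + (-1:ℝ) ^ 1 * exp (-((1:ℕ) * t))) * exp (-x * sinh t)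
      = 2 * (sinh t ^ 1 * exp (-x * sinh t)) := by
    intro t
    rw [Real.sinh_eq]; push_cast; ring_nf
  unfold besselY auxC auxE
  simp_rw [e, e2]
  rw [integral_sub ((by fun_prop : Continuous _).intervalIntegrable _ _)
    ((by fun_prop : Continuous _).intervalIntegrable _ _), h, MeasureTheory.integral_const_mul]
  ring

lemma H0_eq (x : ℝ) : hankelH1 0 x =
    ((auxC 0 x / π : ℝ) : ℂ) + Complex.I * (((auxS 0 x - 2 * auxE 0 x) / π : ℝ) : ℂ) := by
  rw [hankelH1, J0_eq, Y0_eq]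

lemma H1_eq {x : ℝ} (hx : 0 < x) : hankelH1 1 x =
    ((auxS 1 x / π : ℝ) : ℂ) + Complex.I * (((-auxC 1 x - 2 * auxE 1 x) / π : ℝ) : ℂ) := by
  rw [hankelH1, J1_eq hx, Y1_eq hx]

lemma H0_deriv {x : ℝ} (hx : 0 < x) : HasDerivAt (hankelH1 0) (-hankelH1 1 x) x := by
  have hf : hankelH1 0 = fun x => ((auxC 0 x / π : ℝ) : ℂ) +
    Complex.I * (((auxS 0 x - 2 * auxE 0 x) / π : ℝ) : ℂ) := funext H0_eq
  rw [hf, H1_eq hx]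
  have h1 := ((auxC_deriv 0 x).div_const π).ofReal_comp
  have h2 := (((auxS_deriv 0 x).sub ((auxE_deriv (n := 0) (by norm_num) hx).const_mul 2)).div_const
    π).ofReal_comp
  refine (h1.add (h2.const_mul Complex.I)).congr_deriv ?_
  push_cast; ring

lemma xH1_deriv {x : ℝ} (hx : 0 < x) :
    HasDerivAt (fun x : ℝ => (x : ℂ) * hankelH1 1 x) (x * hankelH1 0 x) x := by
  have hf : (fun x : ℝ => (x : ℂ) * hankelH1 1 x) =ᶠ[𝓝 x] fun x => ((x * (auxS 1 x / π) : ℝ) : ℂ) +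
    Complex.I * ((x * ((-auxC 1 x - 2 * auxE 1 x) / π) : ℝ) : ℂ) := by
    filter_upwards [Ioi_mem_nhds hx] with y hy
    rw [H1_eq hy]; push_cast; ring
  refine HasDerivAt.congr_of_eventuallyEq ?_ hf
  rw [H0_eq]
  have h1 := ((hasDerivAt_id x).mul ((auxS_deriv 1 x).div_const π)).ofReal_comp
  have h2 := ((hasDerivAt_id x).mul (((auxC_deriv 1 x).neg.sub
    ((auxE_deriv (n := 1) (by norm_num) hx).const_mul 2)).div_const π)).ofReal_comp
  refine (h1.add (h2.const_mul Complex.I)).congr_deriv ?_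
  have p1 : auxS 1 x = x * (auxC 0 x - auxC 2 x) := (partsC x).symm
  have p2 : auxC 1 x = 2 - x * (auxS 0 x - auxS 2 x) := by linarith [partsS x]
  have p3 : auxE 1 x = x * (auxE 0 x + auxE 2 x) - 1 := by linarith [partsE hx]
  simp only [id, Pi.neg_apply, Pi.sub_apply, Nat.reduceAdd, p1, p2, p3]
  push_cast; ring

lemma xE0_bound {x : ℝ} (hx : 0 < x) (hx1 : x ≤ 1) {t : ℝ} (ht : 0 ≤ t) :
    x * exp (-x * sinh t) ≤ 3 * exp (-t) := by
  have hs : 0 ≤ sinh t := sinh_nonneg_iff.2 ht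
  have h1 := exp_le_sinh ht
  have e1 : exp t * exp (-t) = 1 := by rw [← exp_add]; simp
  have e2 : exp (-x * sinh t) * exp (x * sinh t) = 1 := by rw [← exp_add]; ring_nf; simp
  have h2 : x * sinh t + 1 ≤ exp (x * sinh t) := add_one_le_exp _
  have h3 : x * exp t ≤ 3 * exp (x * sinh t) := by nlinarith
  calc x * exp (-x * sinh t) = (x * exp t) * (exp (-t) * exp (-x * sinh t)) := by
        linear_combination -(x * exp (-x * sinh t)) * e1
    _ ≤ (3 * exp (x * sinh t)) * (exp (-t) * exp (-x * sinh t)) := by gcongr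
    _ = _ := by linear_combination (3 * exp (-t)) * e2

lemma small : ∀ᶠ x : ℝ in 𝓝[>] 0, 0 < x ∧ x ≤ 1 := by
  filter_upwards [Ioc_mem_nhdsGT (zero_lt_one' ℝ)] with x hx using hx

lemma xE0_lim : Tendsto (fun x => x * auxE 0 x) (𝓝[>] 0) (𝓝 0) := by
  have : Tendsto (fun x : ℝ => ∫ t in Ioi (0:ℝ), x * exp (-x * sinh t)) (𝓝[>] 0)
      (𝓝 (∫ t in Ioi (0:ℝ), (0:ℝ))) := by
    refine tendsto_integral_filter_of_dominated_convergence (fun t => 3 * exp (-t)) ?_ ?_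
      (exp_neg_int.const_mul 3) ?_
    · exact Eventually.of_forall fun y =>
        (by have := Real.continuous_sinh; fun_prop : Continuous _).aestronglyMeasurable
    · filter_upwards [small] with x hx
      filter_upwards [ae_restrict_mem measurableSet_Ioi] with t ht
      have := hx.1
      rw [Real.norm_eq_abs, abs_of_nonneg (by positivity)]
      exact xE0_bound hx.1 hx.2 (le_of_lt ht)
    · refine Eventually.of_forall fun t => ?_
      have : Continuous fun x : ℝ => x * exp (-x * sinh t) := by fun_prop
      simpa using (this.tendsto 0).mono_left nhdsWithin_le_nhds
  simp only [MeasureTheory.integral_const_mul, MeasureTheory.integral_zero] at this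
  simpa [auxE] using this

lemma xE1_lim : Tendsto (fun x => x * auxE 1 x) (𝓝[>] 0) (𝓝 1) := by
  have h : ∀ x : ℝ, 0 < x → x * auxE 1 x =
      1 - x * ∫ t in Ioi (0:ℝ), exp (-t) * exp (-x * sinh t) := by
    intro x hx
    have i1 := sinh_int hx (n := 1) (by norm_num)
    have ic := cosh_int hx (n := 1) (by norm_num)
    have h : ∫ t in Ioi (0:ℝ), x * (cosh t ^ 1 * exp (-x * sinh t))
         = 0 - (-(exp (-x * sinh 0))) := by
      refine integral_Ioi_of_hasDerivAt_of_tendsto' (f := fun t => -(exp (-x * sinh t)))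
        (fun t _ => ?_) (ic.const_mul x) ?_
      · have h := (((hasDerivAt_sinh t).const_mul (-x)).exp).neg
        refine h.congr_deriv ?_
        ring
      · simpa using (tendsto_aux hx (g := fun _ => 1) fun t ht => by simpa using ht).neg
    have e : ∀ t, exp (-t) * exp (-x * sinh t) =
        cosh t ^ 1 * exp (-x * sinh t) - sinh t ^ 1 * exp (-x * sinh t) := by
      intro t; rw [← Real.cosh_sub_sinh]; ring
    simp_rw [e]
    rw [MeasureTheory.integral_sub ic i1]
    rw [MeasureTheory.integral_const_mul] at h
    simp only [sinh_zero, mul_zero, exp_zero] at h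
    unfold auxE
    linarith
  have h2 : Tendsto (fun x : ℝ => x * ∫ t in Ioi (0:ℝ), exp (-t) * exp (-x * sinh t))
      (𝓝[>] 0) (𝓝 0) := by
    refine squeeze_zero_norm' (a := fun x => x) ?_ nhdsWithin_le_nhds
    filter_upwards [self_mem_nhdsWithin] with x hx
    have hx : 0 < x := hx
    have : ‖∫ t in Ioi (0:ℝ), exp (-t) * exp (-x * sinh t)‖ ≤ ∫ t in Ioi (0:ℝ), exp (-t) := by
      refine norm_integral_le_of_norm_le exp_neg_int ?_
      filter_upwards [ae_restrict_mem measurableSet_Ioi] with t ht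
      have hs : 0 ≤ sinh t := sinh_nonneg_iff.2 (le_of_lt ht)
      rw [norm_mul, Real.norm_eq_abs, Real.norm_eq_abs, abs_exp, abs_exp]
      refine mul_le_of_le_one_right (exp_pos _).le (exp_le_one_iff.2 ?_)
      nlinarith
    rw [integral_exp_neg_Ioi_zero] at this
    rw [norm_mul, Real.norm_eq_abs, abs_of_pos hx]
    nlinarith
  have h3 : Tendsto (fun x : ℝ => 1 - x * ∫ t in Ioi (0:ℝ), exp (-t) * exp (-x * sinh t))
      (𝓝[>] 0) (𝓝 1) := by simpa using h2.const_sub 1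
  refine h3.congr' ?_
  filter_upwards [self_mem_nhdsWithin] with x hx using (h x hx).symm

lemma x_cont {f : ℝ → ℝ} {f' : ℝ} (hf : HasDerivAt f f' 0) :
    Tendsto (fun x => x * f x) (𝓝[>] 0) (𝓝 0) := by
  have : ContinuousAt (fun x => x * f x) 0 := continuousAt_id.mul hf.continuousAt
  simpa using this.tendsto.mono_left nhdsWithin_le_nhds

lemma xH0_lim : Tendsto (fun x : ℝ => (x : ℂ) * hankelH1 0 x) (𝓝[>] 0) (𝓝 0) := by
  have h1 := ((x_cont (auxC_deriv 0 0)).div_const π).ofReal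
  have h2 := (((x_cont (auxS_deriv 0 0)).sub (xE0_lim.const_mul 2)).div_const π).ofReal
  have := h1.add (h2.const_mul Complex.I)
  convert this using 2 with x
  · rw [H0_eq]; push_cast; ring
  · simp

lemma xH1_lim : Tendsto (fun x : ℝ => (x : ℂ) * hankelH1 1 x) (𝓝[>] 0)
    (𝓝 (-(2 * Complex.I / (π : ℂ)))) := by
  have h1 := ((x_cont (auxS_deriv 1 0)).div_const π).ofReal
  have h2 := (((x_cont (auxC_deriv 1 0)).neg.sub (xE1_lim.const_mul 2)).div_const π).ofReal
  have := h1.add (h2.const_mul Complex.I)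
  have e : -(2 * Complex.I / (π : ℂ)) =
    ((0 / π : ℝ) : ℂ) + Complex.I * (((-0 - 2 * 1) / π : ℝ) : ℂ) := by push_cast; ring
  rw [e]
  refine this.congr' ?_
  filter_upwards [self_mem_nhdsWithin] with x hx
  rw [H1_eq hx]; push_cast; ring

lemma H0_cont : ContinuousOn (hankelH1 0) (Ioi 0) :=
  fun _ hx => (H0_deriv hx).continuousAt.continuousWithinAt

lemma H1_cont : ContinuousOn (hankelH1 1) (Ioi 0) := by
  have h : ContinuousOn (fun x : ℝ => ((x : ℂ) * hankelH1 1 x) / (x : ℂ)) (Ioi 0) := by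
    refine ContinuousOn.div (fun _ hx => (xH1_deriv hx).continuousAt.continuousWithinAt)
      Complex.continuous_ofReal.continuousOn fun x hx => ?_
    exact_mod_cast (ne_of_gt hx)
  refine h.congr fun x hx => ?_
  have : (x : ℂ) ≠ 0 := by exact_mod_cast (ne_of_gt hx)
  field_simp

noncomputable def primF (k l x : ℝ) : ℂ :=
  (1 / ((k : ℂ) ^ 2 * l)) * ((x : ℂ) * hankelH1 0 (k * (l - x)))
    + (1 / ((k : ℂ) ^ 4 * (l : ℂ) ^ 2)) *
      (((k * (l - x) : ℝ) : ℂ) * hankelH1 1 (k * (l - x)) - ((k * x : ℝ) : ℂ) * hankelH1 1 (k * x))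

lemma primF_deriv {k l x : ℝ} (hk : 0 < k) (hl : 0 < l) (hx : 0 < x) (hxl : x < l) :
    HasDerivAt (primF k l) (upsDelta k l x) x := by
  have a1 : 0 < k * x := by positivity
  have a2 : 0 < k * (l - x) := mul_pos hk (by linarith)
  have d1 : HasDerivAt (fun x : ℝ => k * x) k x := by simpa using (hasDerivAt_id x).const_mul k
  have d2 : HasDerivAt (fun x : ℝ => k * (l - x)) (-k) x := by
    simpa using ((hasDerivAt_id x).const_sub l).const_mul k
  have b1 := (H0_deriv a2).scomp x d2
  have b2 := (xH1_deriv a2).scomp x d2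
  have b3 := (xH1_deriv a1).scomp x d1
  have c := (((hasDerivAt_id x).ofReal_comp.mul b1).const_mul (1 / ((k : ℂ) ^ 2 * l))).add
    ((b2.sub b3).const_mul (1 / ((k : ℂ) ^ 4 * (l : ℂ) ^ 2)))
  have hk' : (k : ℂ) ≠ 0 := by exact_mod_cast hk.ne'
  have hl' : (l : ℂ) ≠ 0 := by exact_mod_cast hl.ne'
  refine c.congr_deriv ?_
  simp only [upsDelta, upsGamma, upsBeta, upsAlpha, Function.comp, Complex.real_smul, id]
  push_cast
  field_simp
  ring

lemma ups_cont {k l : ℝ} (hk : 0 < k) : ContinuousOn (upsDelta k l) (Ioo 0 l) := by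
  have m1 : MapsTo (fun x : ℝ => k * x) (Ioo 0 l) (Ioi 0) := fun x hx => mul_pos hk hx.1
  have m2 : MapsTo (fun x : ℝ => k * (l - x)) (Ioo 0 l) (Ioi 0) :=
    fun x hx => mul_pos hk (by linarith [hx.2])
  have c1 : ContinuousOn (fun x : ℝ => hankelH1 0 (k * x)) (Ioo 0 l) :=
    H0_cont.comp (by fun_prop) m1
  have c2 : ContinuousOn (fun x : ℝ => hankelH1 1 (k * x)) (Ioo 0 l) :=
    H1_cont.comp (by fun_prop) m1
  have c3 : ContinuousOn (fun x : ℝ => hankelH1 0 (k * (l - x))) (Ioo 0 l) :=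
    H0_cont.comp (by fun_prop) m2
  have c4 : ContinuousOn (fun x : ℝ => hankelH1 1 (k * (l - x))) (Ioo 0 l) :=
    H1_cont.comp (by fun_prop) m2
  unfold upsDelta upsGamma upsBeta upsAlpha
  fun_prop

/-- the limit as `ε → 0⁺` of
`∫_ε^{l−ε} Υ_δ(x) dx − (1/k²)·H₀⁽¹⁾(kε)` is `−(2/(k⁴l²))·[kl·H₁⁽¹⁾(kl) + 2i/π]`. -/
theorem statement16 (k l : ℝ) (hk : 0 < k) (hl : 0 < l) :
    Filter.Tendsto
      (fun ε : ℝ =>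
        (∫ x in ε..(l - ε), upsDelta k l x) - (1 / (k : ℂ) ^ 2) * hankelH1 0 (k * ε))
      (nhdsWithin 0 (Set.Ioi 0))
      (nhds (-(2 / ((k : ℂ) ^ 4 * (l : ℂ) ^ 2)) *
        (((k * l : ℝ) : ℂ) * hankelH1 1 (k * l) + 2 * Complex.I / (π : ℂ)))) := by
  have hk' : (k : ℂ) ≠ 0 := by exact_mod_cast hk.ne'
  have hl' : (l : ℂ) ≠ 0 := by exact_mod_cast hl.ne'
  have hkl : 0 < k * l := by positivity
  have t1 : Tendsto (fun ε : ℝ => k * ε) (𝓝[>] 0) (𝓝[>] 0) := by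
    refine tendsto_nhdsWithin_iff.2 ⟨?_, ?_⟩
    · have : Continuous fun ε : ℝ => k * ε := by fun_prop
      simpa using (this.tendsto 0).mono_left nhdsWithin_le_nhds
    · filter_upwards [self_mem_nhdsWithin] with x hx using mul_pos hk hx
  have t2 : Tendsto (fun ε : ℝ => k * (l - ε)) (𝓝[>] 0) (𝓝 (k * l)) := by
    have : Continuous fun ε : ℝ => k * (l - ε) := by fun_prop
    simpa using (this.tendsto 0).mono_left nhdsWithin_le_nhds
  have t3 : Tendsto (fun ε : ℝ => (ε : ℂ)) (𝓝[>] 0) (𝓝 0) := by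
    simpa using (Complex.continuous_ofReal.tendsto 0).mono_left nhdsWithin_le_nhds
  have l1 := xH0_lim.comp t1
  have l2 := xH1_lim.comp t1
  have l3 := (xH1_deriv hkl).continuousAt.tendsto.comp t2
  have l4 := t3.mul ((H0_deriv hkl).continuousAt.tendsto.comp t2)
  have L := (((l1.const_mul (1 / (k : ℂ))).add l4).const_mul (-(1 / ((k : ℂ) ^ 2 * l)))).add
    ((l2.sub l3).const_mul (2 / ((k : ℂ) ^ 4 * (l : ℂ) ^ 2)))
  have e : -(2 / ((k : ℂ) ^ 4 * (l : ℂ) ^ 2)) *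
        (((k * l : ℝ) : ℂ) * hankelH1 1 (k * l) + 2 * Complex.I / (π : ℂ)) =
      -(1 / ((k : ℂ) ^ 2 * l)) * (1 / (k : ℂ) * 0 + 0 * hankelH1 0 (k * l)) +
      2 / ((k : ℂ) ^ 4 * (l : ℂ) ^ 2) *
        (-(2 * Complex.I / (π : ℂ)) - ((k * l : ℝ) : ℂ) * hankelH1 1 (k * l)) := by
    ring
  rw [e]
  refine L.congr' ?_
  filter_upwards [Ioo_mem_nhdsGT (half_pos hl)] with ε hε
  have hsub : uIcc ε (l - ε) ⊆ Ioo 0 l := by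
    rw [uIcc_of_le (by linarith [hε.2])]
    intro y hy
    exact ⟨by linarith [hε.1, hy.1], by linarith [hε.1, hy.2]⟩
  rw [integral_eq_sub_of_hasDerivAt
    (fun y hy => primF_deriv hk hl (hsub hy).1 (hsub hy).2)
    ((ups_cont hk).mono hsub).intervalIntegrable]
  simp only [primF, Function.comp, sub_sub_cancel]
  push_cast
  field_simp
  ring
end

section
/- For all reals k, l > 0, the limit as ε → 0⁺ of [ (i k²/4)·∫_ε^{l−ε} (Υ_α(x) − Υ_β(x) − Υ_γ(x) + Υ_δ(x)) dx + (1/(2π))·log ε ] exists and equals i/4 − (i/(2kl))·H₁⁽¹⁾(kl) − (1/(2π))·(γ_E + log(k/2)) + 1/(π k² l²), where γ_E is the Euler–Mascheroni constant. In particular, the logarithmic divergence of the regularized coincident hypersingular integral is exactly −(1/(2π))·log ε. -/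
open MeasureTheory Set Filter Topology Real intervalIntegral

/-! ### Finite integrals -/

noncomputable def bA (n : ℕ) (x : ℝ) : ℝ := ∫ τ in (0:ℝ)..π, Real.sin τ ^ n * Real.cos (x * Real.sin τ)
noncomputable def bB (n : ℕ) (x : ℝ) : ℝ := ∫ τ in (0:ℝ)..π, Real.sin τ ^ n * Real.sin (x * Real.sin τ)
noncomputable def bL (n : ℕ) (x : ℝ) : ℝ :=
  ∫ t in Set.Ioi (0:ℝ), Real.sinh t ^ n * Real.exp (-x * Real.sinh t)

lemma bA_deriv (n : ℕ) (x : ℝ) : HasDerivAt (bA n) (-bB (n+1) x) x := by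
  have h := (intervalIntegral.hasDerivAt_integral_of_dominated_loc_of_deriv_le (μ := volume)
    (a := 0) (b := π) (bound := fun _ => (1:ℝ))
    (F := fun x τ => Real.sin τ ^ n * Real.cos (x * Real.sin τ))
    (F' := fun x τ => -(Real.sin τ ^ (n+1) * Real.sin (x * Real.sin τ))) (x₀ := x) (s := Set.univ)
    Filter.univ_mem (Eventually.of_forall fun y => by
      apply Continuous.aestronglyMeasurable; fun_prop)
    (by apply Continuous.intervalIntegrable; fun_prop)
    (by apply Continuous.aestronglyMeasurable; fun_prop)
    (by
      refine Eventually.of_forall fun t _ y _ => ?_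
      rw [norm_neg, norm_mul, norm_pow]
      exact mul_le_one₀ (pow_le_one₀ (norm_nonneg _) (Real.abs_sin_le_one _)) (norm_nonneg _)
        (Real.abs_sin_le_one _))
    (by simp)
    (by
      refine Eventually.of_forall fun t _ y _ => ?_
      have := ((Real.hasDerivAt_cos (y * Real.sin t)).comp y
        ((hasDerivAt_id y).mul_const (Real.sin t))).const_mul (Real.sin t ^ n)
      refine this.congr_deriv ?_
      ring)).2
  rw [intervalIntegral.integral_neg] at h
  exact h

lemma bB_deriv (n : ℕ) (x : ℝ) : HasDerivAt (bB n) (bA (n+1) x) x := by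
  have h := (intervalIntegral.hasDerivAt_integral_of_dominated_loc_of_deriv_le (μ := volume)
    (a := 0) (b := π) (bound := fun _ => (1:ℝ))
    (F := fun x τ => Real.sin τ ^ n * Real.sin (x * Real.sin τ))
    (F' := fun x τ => (Real.sin τ ^ (n+1) * Real.cos (x * Real.sin τ))) (x₀ := x) (s := Set.univ)
    Filter.univ_mem (Eventually.of_forall fun y => by
      apply Continuous.aestronglyMeasurable; fun_prop)
    (by apply Continuous.intervalIntegrable; fun_prop)
    (by apply Continuous.aestronglyMeasurable; fun_prop)
    (by
      refine Eventually.of_forall fun t _ y _ => ?_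
      rw [norm_mul, norm_pow]
      exact mul_le_one₀ (pow_le_one₀ (norm_nonneg _) (Real.abs_sin_le_one _)) (norm_nonneg _)
        (Real.abs_cos_le_one _))
    (by simp)
    (by
      refine Eventually.of_forall fun t _ y _ => ?_
      have := ((Real.hasDerivAt_sin (y * Real.sin t)).comp y
        ((hasDerivAt_id y).mul_const (Real.sin t))).const_mul (Real.sin t ^ n)
      refine this.congr_deriv ?_
      ring)).2
  exact h

lemma int_cos_cos (x : ℝ) (hx : x ≠ 0) :
    ∫ τ in (0:ℝ)..π, Real.cos τ * Real.cos (x * Real.sin τ) = 0 := by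
  rw [intervalIntegral.integral_eq_sub_of_hasDerivAt
    (f := fun τ => Real.sin (x * Real.sin τ) / x)]
  · simp
  · intro t _
    have := ((Real.hasDerivAt_sin (x * Real.sin t)).comp t
      ((Real.hasDerivAt_sin t).const_mul x)).div_const x
    refine this.congr_deriv ?_
    field_simp
  · apply Continuous.intervalIntegrable; fun_prop

lemma int_cos_sin (x : ℝ) (hx : x ≠ 0) :
    ∫ τ in (0:ℝ)..π, Real.cos τ * Real.sin (x * Real.sin τ) = 0 := by
  rw [intervalIntegral.integral_eq_sub_of_hasDerivAt
    (f := fun τ => -Real.cos (x * Real.sin τ) / x)]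
  · simp
  · intro t _
    have := ((Real.hasDerivAt_cos (x * Real.sin t)).comp t
      ((Real.hasDerivAt_sin t).const_mul x)).neg.div_const x
    refine this.congr_deriv ?_
    field_simp
  · apply Continuous.intervalIntegrable; fun_prop

lemma bA_rec (x : ℝ) : x * (bA 0 x - bA 2 x) = bB 1 x := by
  have h : ∫ τ in (0:ℝ)..π, (x * (Real.sin τ ^ 0 * Real.cos (x * Real.sin τ)
      - Real.sin τ ^ 2 * Real.cos (x * Real.sin τ))
      - Real.sin τ ^ 1 * Real.sin (x * Real.sin τ)) = 0 := by
    rw [intervalIntegral.integral_eq_sub_of_hasDerivAt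
      (f := fun τ => Real.cos τ * Real.sin (x * Real.sin τ))]
    · simp
    · intro t _
      have := (Real.hasDerivAt_cos t).mul ((Real.hasDerivAt_sin (x * Real.sin t)).comp t
        ((Real.hasDerivAt_sin t).const_mul x))
      refine this.congr_deriv ?_
      simp only [Function.comp]
      linear_combination (-x * Real.cos (x * Real.sin t)) * (Real.sin_sq_add_cos_sq t).symm
    · apply Continuous.intervalIntegrable; fun_prop
  rw [intervalIntegral.integral_sub, intervalIntegral.integral_const_mul,
    intervalIntegral.integral_sub] at h
  · unfold bA bB; linarith
  all_goals apply Continuous.intervalIntegrable; fun_prop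

lemma bB_rec (x : ℝ) : x * (bB 0 x - bB 2 x) = 2 - bA 1 x := by
  have h : ∫ τ in (0:ℝ)..π, (x * (Real.sin τ ^ 0 * Real.sin (x * Real.sin τ)
      - Real.sin τ ^ 2 * Real.sin (x * Real.sin τ))
      + Real.sin τ ^ 1 * Real.cos (x * Real.sin τ)) = 2 := by
    rw [intervalIntegral.integral_eq_sub_of_hasDerivAt
      (f := fun τ => -(Real.cos τ * Real.cos (x * Real.sin τ)))]
    · simp; norm_num
    · intro t _
      have := ((Real.hasDerivAt_cos t).mul ((Real.hasDerivAt_cos (x * Real.sin t)).comp t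
        ((Real.hasDerivAt_sin t).const_mul x))).neg
      refine this.congr_deriv ?_
      simp only [Function.comp]
      linear_combination (-x * Real.sin (x * Real.sin t)) * (Real.sin_sq_add_cos_sq t).symm
    · apply Continuous.intervalIntegrable; fun_prop
  rw [intervalIntegral.integral_add, intervalIntegral.integral_const_mul,
    intervalIntegral.integral_sub] at h
  · unfold bA bB; linarith
  all_goals apply Continuous.intervalIntegrable; fun_prop

lemma bJ0 (x : ℝ) : besselJ 0 x = (1/π) * bA 0 x := by
  simp [besselJ, bA]

lemma bJ1 (x : ℝ) (hx : x ≠ 0) : besselJ 1 x = (1/π) * bB 1 x := by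
  unfold besselJ bB
  congr 1
  have : ∀ τ : ℝ, Real.cos (((1:ℕ):ℝ) * τ - x * Real.sin τ)
      = Real.cos τ * Real.cos (x * Real.sin τ) + Real.sin τ ^ 1 * Real.sin (x * Real.sin τ) := by
    intro τ; rw [Real.cos_sub]; simp
  simp_rw [this]
  rw [intervalIntegral.integral_add, int_cos_cos x hx, zero_add]
  all_goals apply Continuous.intervalIntegrable; fun_prop

lemma bY0 (x : ℝ) : besselY 0 x = (1/π) * bB 0 x - (2/π) * bL 0 x := by
  simp [besselY, bB, bL]
  rw [MeasureTheory.integral_const_mul]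
  ring

lemma bY1 (x : ℝ) (hx : x ≠ 0) : besselY 1 x = -(1/π) * bA 1 x - (2/π) * bL 1 x := by
  unfold besselY bA bL
  have : ∀ τ : ℝ, Real.sin (x * Real.sin τ - ((1:ℕ):ℝ) * τ)
      = Real.cos τ * Real.sin (x * Real.sin τ) - Real.sin τ ^ 1 * Real.cos (x * Real.sin τ) := by
    intro τ; rw [Real.sin_sub]; simp; ring
  simp_rw [this]
  rw [intervalIntegral.integral_sub, int_cos_sin x hx, zero_sub]
  · have : ∀ t : ℝ, (Real.exp (((1:ℕ):ℝ) * t) + (-1 : ℝ) ^ 1 * Real.exp (-(((1:ℕ):ℝ) * t)))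
        * Real.exp (-x * Real.sinh t) = 2 * (Real.sinh t ^ 1 * Real.exp (-x * Real.sinh t)) := by
      intro t; rw [Real.sinh_eq]; simp; ring
    simp_rw [this]
    rw [MeasureTheory.integral_const_mul]
    ring
  all_goals apply Continuous.intervalIntegrable; fun_prop

/-! ### Infinite integrals -/

lemma sinh_lb (t : ℝ) (ht : 0 ≤ t) : t ^ 2 / 4 ≤ Real.sinh t := by
  have h1 := Real.quadratic_le_exp_of_nonneg ht
  have h2 : Real.exp (-t) ≤ 1 := by simpa using ht
  rw [Real.sinh_eq]; linarith

lemma exp_bd (n : ℕ) (x t : ℝ) (hx : 0 < x) (ht : 0 ≤ t) :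
    Real.exp (n * t) * Real.exp (-x * Real.sinh t) ≤ Real.exp ((n+1)^2 / x) * Real.exp (-t) := by
  rw [← Real.exp_add, ← Real.exp_add]
  apply Real.exp_le_exp.mpr
  have h := mul_le_mul_of_nonneg_left (sinh_lb t ht) hx.le
  have h2 : 0 ≤ ((n:ℝ)+1)^2 / x - (n+1) * t + x * (t^2/4) := by
    have : ((n:ℝ)+1)^2 / x - (n+1) * t + x * (t^2/4) = ((n+1) - x * t / 2)^2 / x := by
      field_simp; ring
    rw [this]; positivity
  linarith

lemma integrable_of_bd (n : ℕ) (x : ℝ) (hx : 0 < x) (ψ : ℝ → ℝ) (hψ : Continuous ψ)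
    (hb : ∀ t, 0 < t → |ψ t| ≤ Real.exp (n * t)) :
    IntegrableOn (fun t => ψ t * Real.exp (-x * Real.sinh t)) (Ioi 0) := by
  have h1 : IntegrableOn (fun t : ℝ => Real.exp ((n+1)^2 / x) * Real.exp (-t)) (Ioi 0) :=
    (integrableOn_exp_neg_Ioi 0).const_mul _
  refine Integrable.mono' h1 ?_ ?_
  · apply Continuous.aestronglyMeasurable; fun_prop
  · refine (ae_restrict_iff' measurableSet_Ioi).mpr (Eventually.of_forall fun t ht => ?_)
    rw [norm_mul, Real.norm_eq_abs, Real.norm_eq_abs, Real.abs_exp]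
    exact (mul_le_mul_of_nonneg_right (hb t ht) (Real.exp_pos _).le).trans
      (exp_bd n x t hx (le_of_lt ht))

lemma sinh_le_exp_s18 (t : ℝ) : Real.sinh t ≤ Real.exp t := by
  rw [Real.sinh_eq]; linarith [Real.exp_pos t, Real.exp_pos (-t)]

lemma cosh_le_exp' (t : ℝ) (ht : 0 ≤ t) : Real.cosh t ≤ Real.exp t := by
  rw [Real.cosh_eq]
  have : Real.exp (-t) ≤ Real.exp t := Real.exp_le_exp.mpr (by linarith)
  linarith

lemma sinh_pow_bd (n : ℕ) (t : ℝ) (ht : 0 < t) : |Real.sinh t ^ n| ≤ Real.exp (n * t) := by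
  rw [abs_pow, abs_of_pos (Real.sinh_pos_iff.mpr ht), Real.exp_nat_mul]
  exact pow_le_pow_left₀ (Real.sinh_pos_iff.mpr ht).le (sinh_le_exp_s18 t) n

lemma bL_int (n : ℕ) (x : ℝ) (hx : 0 < x) :
    IntegrableOn (fun t => Real.sinh t ^ n * Real.exp (-x * Real.sinh t)) (Ioi 0) :=
  integrable_of_bd n x hx _ (by fun_prop) (sinh_pow_bd n)

lemma bL_deriv (n : ℕ) (x : ℝ) (hx : 0 < x) : HasDerivAt (bL n) (-bL (n+1) x) x := by
  have h := (hasDerivAt_integral_of_dominated_loc_of_deriv_le (μ := volume.restrict (Ioi (0:ℝ)))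
    (bound := fun t => Real.sinh t ^ (n+1) * Real.exp (-(x/2) * Real.sinh t))
    (F := fun x t => Real.sinh t ^ n * Real.exp (-x * Real.sinh t))
    (F' := fun x t => -(Real.sinh t ^ (n+1) * Real.exp (-x * Real.sinh t)))
    (x₀ := x) (s := Ioi (x/2)) (Ioi_mem_nhds (by linarith))
    (Eventually.of_forall fun y => by
      apply Continuous.aestronglyMeasurable; fun_prop)
    (bL_int n x hx)
    (by apply Continuous.aestronglyMeasurable; fun_prop)
    (by
      refine (ae_restrict_iff' measurableSet_Ioi).mpr (Eventually.of_forall fun t ht y hy => ?_)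
      have hs : 0 < Real.sinh t := Real.sinh_pos_iff.mpr ht
      have hy' : x / 2 < y := hy
      rw [norm_neg, norm_mul, Real.norm_of_nonneg (by positivity),
        Real.norm_of_nonneg (by positivity)]
      gcongr)
    (bL_int (n+1) (x/2) (by linarith))
    (by
      refine Eventually.of_forall fun t y _ => ?_
      have := (((hasDerivAt_id y).neg.mul_const (Real.sinh t)).exp).const_mul (Real.sinh t ^ n)
      refine this.congr_deriv ?_
      simp; ring)).2
  rw [MeasureTheory.integral_neg] at h
  exact h

lemma tendsto_bd (n : ℕ) (x : ℝ) (hx : 0 < x) (ψ : ℝ → ℝ)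
    (hb : ∀ t, 0 < t → |ψ t| ≤ Real.exp (n * t)) :
    Tendsto (fun t => ψ t * Real.exp (-x * Real.sinh t)) atTop (𝓝 0) := by
  apply squeeze_zero_norm' (a := fun t : ℝ => Real.exp ((n+1)^2 / x) * Real.exp (-t))
  · filter_upwards [eventually_gt_atTop 0] with t ht
    rw [norm_mul, Real.norm_eq_abs, Real.norm_eq_abs, Real.abs_exp]
    exact (mul_le_mul_of_nonneg_right (hb t ht) (Real.exp_pos _).le).trans
      (exp_bd n x t hx (le_of_lt ht))
  · simpa using (Real.tendsto_exp_neg_atTop_nhds_zero).const_mul (Real.exp ((n+1)^2 / x))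

lemma hasDerivAt_E (x t : ℝ) : HasDerivAt (fun t => Real.exp (-x * Real.sinh t))
    (-(x * Real.cosh t * Real.exp (-x * Real.sinh t))) t := by
  have := ((Real.hasDerivAt_sinh t).const_mul (-x)).exp
  refine this.congr_deriv ?_
  ring

lemma bL_rec (x : ℝ) (hx : 0 < x) : x * (bL 0 x + bL 2 x) = 1 + bL 1 x := by
  have i0 := bL_int 0 x hx
  have i1 := bL_int 1 x hx
  have i2 := bL_int 2 x hx
  have h := MeasureTheory.integral_Ioi_of_hasDerivAt_of_tendsto' (a := 0) (m := 0)
    (f := fun t => Real.cosh t * Real.exp (-x * Real.sinh t))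
    (f' := fun t => Real.sinh t ^ 1 * Real.exp (-x * Real.sinh t)
      - x * (Real.sinh t ^ 0 * Real.exp (-x * Real.sinh t)
        + Real.sinh t ^ 2 * Real.exp (-x * Real.sinh t)))
    (by
      intro t _
      refine ((Real.hasDerivAt_cosh t).mul (hasDerivAt_E x t)).congr_deriv ?_
      linear_combination (-x * Real.exp (-x * Real.sinh t)) * Real.cosh_sq t)
    (i1.sub ((i0.add i2).const_mul x))
    (tendsto_bd 1 x hx _ (fun t ht => by
      rw [abs_of_pos (Real.cosh_pos t)]; simpa using cosh_le_exp' t ht.le))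
  have i02 : IntegrableOn (fun t => x * (Real.sinh t ^ 0 * Real.exp (-x * Real.sinh t)
        + Real.sinh t ^ 2 * Real.exp (-x * Real.sinh t))) (Ioi 0) := (i0.add i2).const_mul x
  rw [MeasureTheory.integral_sub i1 i02,
    MeasureTheory.integral_const_mul, MeasureTheory.integral_add i0 i2] at h
  simp only [Real.cosh_zero, Real.sinh_zero, mul_zero, Real.exp_zero] at h
  unfold bL; linarith

lemma int_cosh (x : ℝ) (hx : 0 < x) :
    x * ∫ t in Ioi (0:ℝ), Real.cosh t * Real.exp (-x * Real.sinh t) = 1 := by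
  have i := integrable_of_bd 1 x hx Real.cosh (by fun_prop) (fun t ht => by
      rw [abs_of_pos (Real.cosh_pos t)]; simpa using cosh_le_exp' t ht.le)
  have h := MeasureTheory.integral_Ioi_of_hasDerivAt_of_tendsto' (a := 0) (m := 0)
    (f := fun t => -((1:ℝ) * Real.exp (-x * Real.sinh t)))
    (f' := fun t => x * (Real.cosh t * Real.exp (-x * Real.sinh t)))
    (by
      intro t _
      refine ((hasDerivAt_E x t).const_mul 1).neg.congr_deriv ?_
      ring)
    (i.const_mul x)
    (by simpa using (tendsto_bd 0 x hx (fun _ => 1) (by simp)).neg)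
  rw [MeasureTheory.integral_const_mul] at h
  simpa using h

lemma bL1_lim : Tendsto (fun x => x * bL 1 x) (𝓝[>] 0) (𝓝 1) := by
  have key : ∀ x : ℝ, 0 < x → 1 - x ≤ x * bL 1 x ∧ x * bL 1 x ≤ 1 := by
    intro x hx
    have ic := integrable_of_bd 1 x hx Real.cosh (by fun_prop) (fun t ht => by
      rw [abs_of_pos (Real.cosh_pos t)]; simpa using cosh_le_exp' t ht.le)
    have i1 := bL_int 1 x hx
    have e : (∫ t in Ioi (0:ℝ), Real.cosh t * Real.exp (-x * Real.sinh t)) - bL 1 x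
        = ∫ t in Ioi (0:ℝ), Real.exp (-t) * Real.exp (-x * Real.sinh t) := by
      unfold bL
      rw [← MeasureTheory.integral_sub ic i1]
      congr 1; ext t
      rw [← Real.cosh_sub_sinh]; ring
    have hpos : 0 ≤ ∫ t in Ioi (0:ℝ), Real.exp (-t) * Real.exp (-x * Real.sinh t) :=
      MeasureTheory.integral_nonneg fun t => by positivity
    have hle : ∫ t in Ioi (0:ℝ), Real.exp (-t) * Real.exp (-x * Real.sinh t) ≤ 1 := by
      rw [← integral_exp_neg_Ioi_zero]
      refine MeasureTheory.setIntegral_mono_on ?_ (integrableOn_exp_neg_Ioi 0) measurableSet_Ioi ?_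
      · exact integrable_of_bd 0 x hx (fun t => Real.exp (-t)) (by fun_prop) (fun t ht => by
          rw [Real.abs_exp]; simpa using ht.le)
      · intro t ht
        have : Real.exp (-x * Real.sinh t) ≤ 1 := by
          rw [Real.exp_le_one_iff]
          have : 0 < Real.sinh t := Real.sinh_pos_iff.mpr ht
          nlinarith
        nlinarith [Real.exp_pos (-t)]
    have h1 := int_cosh x hx
    constructor <;> nlinarith
  have l1 : Tendsto (fun x : ℝ => 1 - x) (𝓝[>] 0) (𝓝 1) := by
    have : ContinuousAt (fun x : ℝ => 1 - x) 0 := by fun_prop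
    simpa [ContinuousAt] using this.tendsto.mono_left (nhdsWithin_le_nhds (s := Ioi 0))
  refine tendsto_of_tendsto_of_tendsto_of_le_of_le' l1 tendsto_const_nhds ?_ ?_
  · filter_upwards [self_mem_nhdsWithin] with x hx using (key x hx).1
  · filter_upwards [self_mem_nhdsWithin] with x hx using (key x hx).2

/-! ### The logarithmic asymptotics -/

lemma abs_log_bd (u : ℝ) (hu : 0 < u) : |Real.log u| ≤ u + 2 * u ^ (-(1/2) : ℝ) := by
  have h0 : 0 < u ^ (-(1/2) : ℝ) := Real.rpow_pos_of_pos hu _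
  rw [abs_le]
  constructor
  · have := Real.log_le_rpow_div (x := u⁻¹) (inv_nonneg.mpr hu.le) (ε := 1/2) (by norm_num)
    rw [Real.log_inv, Real.inv_rpow hu.le, ← Real.rpow_neg hu.le] at this
    linarith
  · linarith [Real.log_le_sub_one_of_pos hu]

lemma log_bd_int : IntegrableOn (fun u : ℝ => Real.exp (-u) * (3 * u + 2 * u ^ (-(1/2) : ℝ))) (Ioi 0) := by
  have h2 := Real.GammaIntegral_convergent (s := 2) (by norm_num)
  have h1 := Real.GammaIntegral_convergent (s := 1/2) (by norm_num)
  have := (h2.const_mul 3).add (h1.const_mul 2)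
  refine this.congr (Eventually.of_forall fun u => ?_)
  norm_num
  ring

lemma log_int : IntegrableOn (fun u : ℝ => Real.exp (-u) * Real.log u) (Ioi 0) := by
  refine Integrable.mono' log_bd_int ?_ ?_
  · exact (by fun_prop : Measurable fun u : ℝ => Real.exp (-u) * Real.log u).aestronglyMeasurable
  · refine (ae_restrict_iff' measurableSet_Ioi).mpr (Eventually.of_forall fun u hu => ?_)
    have hu' : 0 < u := hu
    rw [norm_mul, Real.norm_eq_abs, Real.norm_eq_abs, Real.abs_exp]
    have := abs_log_bd u hu
    gcongr
    linarith

lemma int_log : ∫ u in Ioi (0:ℝ), Real.exp (-u) * Real.log u = -Real.eulerMascheroniConstant := by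
  have h1 := Complex.hasDerivAt_GammaIntegral (s := 1) (by simp)
  have h2 := Complex.hasDerivAt_Gamma_one
  have he : Complex.Gamma =ᶠ[𝓝 1] Complex.GammaIntegral := by
    have : ∀ᶠ s : ℂ in 𝓝 1, 0 < s.re :=
      (Complex.continuous_re.isOpen_preimage _ isOpen_Ioi).mem_nhds (by simp)
    filter_upwards [this] with s hs using Complex.Gamma_eq_integral hs
  have h3 := (h1.congr_of_eventuallyEq he).unique h2
  have h4 : ∫ t in Ioi (0:ℝ), (t:ℂ) ^ ((1:ℂ) - 1) * ((Real.log t : ℂ) * (Real.exp (-t) : ℂ))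
      = ((∫ u in Ioi (0:ℝ), Real.exp (-u) * Real.log u : ℝ) : ℂ) := by
    rw [← integral_complex_ofReal]
    congr 1; ext t
    push_cast; simp; ring
  rw [h4] at h3
  exact_mod_cast h3

lemma bL0_eq (x : ℝ) (hx : 0 < x) :
    bL 0 x = ∫ u in Ioi (0:ℝ), Real.exp (-u) * Real.arsinh (u / x) := by
  have i0 := bL_int 0 x hx
  have ib : ∀ t : ℝ, 0 < t → |t * Real.cosh t| ≤ Real.exp ((2:ℕ) * t) := by
    intro t ht
    have hc := Real.cosh_pos t
    rw [abs_of_pos (by positivity)]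
    have h1 := cosh_le_exp' t ht.le
    have h2 : t ≤ Real.exp t := by linarith [Real.add_one_le_exp t]
    rw [Real.exp_nat_mul, sq]
    exact mul_le_mul h2 h1 hc.le (Real.exp_pos t).le
  have i1 := integrable_of_bd 2 x hx (fun t => t * Real.cosh t) (by fun_prop) ib
  have h := MeasureTheory.integral_Ioi_of_hasDerivAt_of_tendsto' (a := 0) (m := 0)
    (f := fun t => t * Real.exp (-x * Real.sinh t))
    (f' := fun t => Real.sinh t ^ 0 * Real.exp (-x * Real.sinh t)
      - x * (t * Real.cosh t * Real.exp (-x * Real.sinh t)))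
    (by
      intro t _
      refine ((hasDerivAt_id t).mul (hasDerivAt_E x t)).congr_deriv ?_
      simp; ring)
    (i0.sub (i1.const_mul x))
    (tendsto_bd 1 x hx _ (fun t ht => by
      rw [abs_of_pos ht]; simp; linarith [Real.add_one_le_exp t]))
  rw [MeasureTheory.integral_sub i0 (i1.const_mul x)] at h
  have him : (fun t => x * Real.sinh t) '' Ioi 0 = Ioi 0 := by
    ext u; constructor
    · rintro ⟨t, ht, rfl⟩
      exact mul_pos hx (Real.sinh_pos_iff.mpr ht)
    · intro hu
      refine ⟨Real.arsinh (u / x), Real.arsinh_pos_iff.mpr (div_pos hu hx), ?_⟩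
      simp only [Real.sinh_arsinh]; field_simp
  have hs := MeasureTheory.integral_image_eq_integral_abs_deriv_smul (s := Ioi (0:ℝ))
    (f := fun t => x * Real.sinh t) (f' := fun t => x * Real.cosh t) measurableSet_Ioi
    (fun t _ => ((Real.hasDerivAt_sinh t).const_mul x).hasDerivWithinAt)
    (fun a _ b _ hab => Real.sinh_injective (mul_left_cancel₀ hx.ne' hab))
    (fun u => Real.exp (-u) * Real.arsinh (u / x))
  rw [him] at hs
  rw [hs]
  have e : ∀ t : ℝ, |x * Real.cosh t| • (Real.exp (-(x * Real.sinh t)) *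
      Real.arsinh (x * Real.sinh t / x)) = x * (t * Real.cosh t * Real.exp (-x * Real.sinh t)) := by
    intro t
    rw [abs_of_pos (mul_pos hx (Real.cosh_pos t)), mul_div_cancel_left₀ _ hx.ne', Real.arsinh_sinh,
      smul_eq_mul, neg_mul]
    ring
  simp_rw [e]
  unfold bL
  simp only [zero_mul, sub_zero] at h
  linarith

lemma arsinh_add_log (x u : ℝ) (hx : 0 < x) (hu : 0 < u) :
    Real.arsinh (u / x) + Real.log x = Real.log (u + Real.sqrt (u^2 + x^2)) := by
  have h : Real.sqrt (1 + (u/x)^2) = Real.sqrt (u^2 + x^2) / x := by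
    rw [show 1 + (u/x)^2 = (u^2+x^2)/x^2 by field_simp; ring, Real.sqrt_div (by positivity),
      Real.sqrt_sq hx.le]
  rw [Real.arsinh, h, ← Real.log_mul (by positivity) hx.ne']
  congr 1; field_simp

lemma arsinh_int (x : ℝ) (hx : 0 < x) :
    IntegrableOn (fun u : ℝ => Real.exp (-u) * Real.arsinh (u / x)) (Ioi 0) := by
  have h2 := Real.GammaIntegral_convergent (s := 2) (by norm_num)
  refine Integrable.mono' (h2.const_mul (1/x)) ?_ ?_
  · have hc : Continuous fun u : ℝ => Real.arsinh (u / x) :=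
      Real.continuous_arsinh.comp (continuous_id.div_const x)
    exact (Continuous.mul (by fun_prop) hc).aestronglyMeasurable
  · refine (ae_restrict_iff' measurableSet_Ioi).mpr (Eventually.of_forall fun u hu => ?_)
    have hu' : 0 < u := hu
    have hd : 0 < u / x := div_pos hu' hx
    have h0 : 0 < Real.arsinh (u/x) := Real.arsinh_pos_iff.mpr hd
    have h1 : Real.arsinh (u/x) ≤ u/x := by
      have := Real.self_le_sinh_iff.mpr h0.le
      rwa [Real.sinh_arsinh] at this
    rw [norm_mul, Real.norm_eq_abs, Real.norm_eq_abs, Real.abs_exp, abs_of_pos h0]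
    calc _ ≤ Real.exp (-u) * (u/x) := by gcongr
      _ = _ := by norm_num; ring

lemma bL0_lim : Tendsto (fun x => bL 0 x + Real.log x) (𝓝[>] 0)
    (𝓝 (Real.log 2 - Real.eulerMascheroniConstant)) := by
  have e1 : ∀ x : ℝ, 0 < x → bL 0 x + Real.log x
      = ∫ u in Ioi (0:ℝ), Real.exp (-u) * (Real.arsinh (u / x) + Real.log x) := by
    intro x hx
    have h2 : IntegrableOn (fun u : ℝ => Real.exp (-u) * Real.log x) (Ioi 0) :=
      (integrableOn_exp_neg_Ioi 0).mul_const _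
    simp_rw [mul_add]
    rw [MeasureTheory.integral_add (arsinh_int x hx) h2, ← bL0_eq x hx,
      MeasureTheory.integral_mul_const, integral_exp_neg_Ioi_zero, one_mul]
  have e2 : Real.log 2 - Real.eulerMascheroniConstant
      = ∫ u in Ioi (0:ℝ), Real.exp (-u) * (Real.log 2 + Real.log u) := by
    have h2 : IntegrableOn (fun u : ℝ => Real.exp (-u) * Real.log 2) (Ioi 0) :=
      (integrableOn_exp_neg_Ioi 0).mul_const _
    simp_rw [mul_add]
    rw [MeasureTheory.integral_add h2 log_int, int_log,
      MeasureTheory.integral_mul_const, integral_exp_neg_Ioi_zero, one_mul]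
    ring
  rw [e2]
  refine Tendsto.congr' (f₁ := fun x => ∫ u in Ioi (0:ℝ), Real.exp (-u) *
    (Real.arsinh (u / x) + Real.log x)) ?_ ?_
  · filter_upwards [self_mem_nhdsWithin] with x hx using (e1 x hx).symm
  refine MeasureTheory.tendsto_integral_filter_of_dominated_convergence
    (fun u : ℝ => Real.exp (-u) * (3 * u + 2 * u ^ (-(1/2) : ℝ))) ?_ ?_ log_bd_int ?_
  · refine Eventually.of_forall fun x => ?_
    have hc : Continuous fun u : ℝ => Real.arsinh (u / x) :=
      Real.continuous_arsinh.comp (continuous_id.div_const x)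
    exact (Continuous.mul (by fun_prop) (hc.add continuous_const)).aestronglyMeasurable
  · filter_upwards [Ioo_mem_nhdsGT (show (0:ℝ) < 1 by norm_num)] with x hx
    refine (ae_restrict_iff' measurableSet_Ioi).mpr (Eventually.of_forall fun u hu => ?_)
    have hu' : 0 < u := hu
    rw [norm_mul, Real.norm_eq_abs, Real.norm_eq_abs, Real.abs_exp, arsinh_add_log x u hx.1 hu]
    gcongr
    have hb := abs_log_bd u hu
    have hs0 := Real.sqrt_nonneg (u^2 + x^2)
    have hs1 : Real.sqrt (u^2 + x^2) ≤ u + 1 := by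
      apply Real.sqrt_le_iff.mpr
      constructor
      · linarith
      · nlinarith [hx.1, hx.2]
    have hl := Real.log_le_log hu' (show u ≤ u + Real.sqrt (u^2 + x^2) by linarith)
    have hr := Real.log_le_sub_one_of_pos (show 0 < u + Real.sqrt (u^2 + x^2) by linarith)
    have h0 : 0 < u ^ (-(1/2) : ℝ) := Real.rpow_pos_of_pos hu _
    have hn := neg_abs_le (Real.log u)
    rw [abs_le]
    constructor <;> linarith
  · refine (ae_restrict_iff' measurableSet_Ioi).mpr (Eventually.of_forall fun u hu => ?_)
    have hu' : 0 < u := hu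
    apply Tendsto.const_mul
    refine Tendsto.congr' (f₁ := fun x => Real.log (u + Real.sqrt (u^2 + x^2))) ?_ ?_
    · filter_upwards [self_mem_nhdsWithin] with x hx using (arsinh_add_log x u hx hu).symm
    · have hc : ContinuousAt (fun x : ℝ => Real.log (u + Real.sqrt (u^2 + x^2))) 0 := by
        apply ContinuousAt.log
        · fun_prop
        · positivity
      have := hc.tendsto.mono_left (nhdsWithin_le_nhds (s := Ioi 0))
      convert this using 2
      rw [← Real.log_mul (by norm_num) hu'.ne']
      congr 1
      simp [Real.sqrt_sq hu'.le]; ring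

/-! ### Hankel functions -/

lemma hankel0_deriv (x : ℝ) (hx : 0 < x) : HasDerivAt (hankelH1 0) (-hankelH1 1 x) x := by
  have hJ : HasDerivAt (besselJ 0) (-besselJ 1 x) x := by
    have h := (bA_deriv 0 x).const_mul (1/π)
    rw [funext bJ0, bJ1 x hx.ne']
    exact h.congr_deriv (by ring)
  have hY : HasDerivAt (besselY 0) (-besselY 1 x) x := by
    have h := ((bB_deriv 0 x).const_mul (1/π)).sub ((bL_deriv 0 x hx).const_mul (2/π))
    rw [funext bY0, bY1 x hx.ne']
    exact h.congr_deriv (by ring)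
  have h := hJ.ofReal_comp.add (hY.ofReal_comp.const_mul Complex.I)
  refine h.congr_deriv ?_
  simp only [hankelH1]; push_cast; ring

lemma hankel1_deriv (x : ℝ) (hx : 0 < x) :
    HasDerivAt (hankelH1 1) (hankelH1 0 x - hankelH1 1 x / x) x := by
  have hev : ∀ᶠ y : ℝ in 𝓝 x, 0 < y := Ioi_mem_nhds hx
  have hJ : HasDerivAt (besselJ 1) (besselJ 0 x - besselJ 1 x / x) x := by
    have h := (bB_deriv 1 x).const_mul (1/π)
    have h' := h.congr_of_eventuallyEq (f₁ := besselJ 1) (by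
      filter_upwards [hev] with y hy using bJ1 y hy.ne')
    refine h'.congr_deriv ?_
    rw [bJ0, bJ1 x hx.ne', ← bA_rec x]
    field_simp; ring
  have hY : HasDerivAt (besselY 1) (besselY 0 x - besselY 1 x / x) x := by
    have h := ((bA_deriv 1 x).const_mul (-(1/π))).sub ((bL_deriv 1 x hx).const_mul (2/π))
    have h' := h.congr_of_eventuallyEq (f₁ := besselY 1) (by
      filter_upwards [hev] with y hy using bY1 y hy.ne')
    refine h'.congr_deriv ?_
    have r1 := bB_rec x
    have r2 := bL_rec x hx
    rw [bY0, bY1 x hx.ne']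
    rw [show bA 1 x = 2 - x * (bB 0 x - bB 2 x) by linarith,
      show bL 1 x = x * (bL 0 x + bL 2 x) - 1 by linarith]
    field_simp; ring
  have h := hJ.ofReal_comp.add (hY.ofReal_comp.const_mul Complex.I)
  refine h.congr_deriv ?_
  simp only [hankelH1]; push_cast; ring

lemma lim_of_cont {f : ℝ → ℝ} (h : ContinuousAt f 0) : Tendsto f (𝓝[>] 0) (𝓝 (f 0)) :=
  h.tendsto.mono_left nhdsWithin_le_nhds

lemma hankel0_lim : Tendsto (fun x : ℝ => hankelH1 0 x - ((2 / π * Real.log x : ℝ) : ℂ) * Complex.I)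
    (𝓝[>] 0) (𝓝 (1 + ((2 / π * (Real.eulerMascheroniConstant - Real.log 2) : ℝ) : ℂ) * Complex.I)) := by
  have hA : Tendsto (fun x => (1/π) * bA 0 x) (𝓝[>] 0) (𝓝 1) := by
    have := (lim_of_cont (bA_deriv 0 0).continuousAt).const_mul (1/π)
    convert this using 2
    simp [bA, Real.pi_ne_zero]
  have hB : Tendsto (fun x => (1/π) * bB 0 x - (2/π) * (bL 0 x + Real.log x)) (𝓝[>] 0)
      (𝓝 (2 / π * (Real.eulerMascheroniConstant - Real.log 2))) := by
    have := ((lim_of_cont (bB_deriv 0 0).continuousAt).const_mul (1/π)).sub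
      (bL0_lim.const_mul (2/π))
    convert this using 2
    simp [bB]; ring
  have h := ((Complex.continuous_ofReal.tendsto _).comp hA).add
    (((Complex.continuous_ofReal.tendsto _).comp hB).mul_const Complex.I)
  simp only [Complex.ofReal_one] at h
  refine h.congr fun x => ?_
  simp only [Function.comp, hankelH1, bJ0, bY0]
  push_cast; ring

lemma hankel1_lim : Tendsto (fun x : ℝ => (x : ℂ) * hankelH1 1 x)
    (𝓝[>] 0) (𝓝 (((-(2 / π) : ℝ) : ℂ) * Complex.I)) := by
  have hid : Tendsto (fun x : ℝ => x) (𝓝[>] 0) (𝓝 0) := lim_of_cont continuousAt_id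
  have hA : Tendsto (fun x => x * ((1/π) * bB 1 x)) (𝓝[>] 0) (𝓝 0) := by
    have := hid.mul ((lim_of_cont (bB_deriv 1 0).continuousAt).const_mul (1/π))
    simpa using this
  have hB : Tendsto (fun x => -(x * ((1/π) * bA 1 x)) - (2/π) * (x * bL 1 x)) (𝓝[>] 0)
      (𝓝 (-(2 / π))) := by
    have := ((hid.mul ((lim_of_cont (bA_deriv 1 0).continuousAt).const_mul (1/π))).neg).sub
      (bL1_lim.const_mul (2/π))
    simpa using this
  have h := ((Complex.continuous_ofReal.tendsto _).comp hA).add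
    (((Complex.continuous_ofReal.tendsto _).comp hB).mul_const Complex.I)
  simp only [Complex.ofReal_zero, zero_add] at h
  refine h.congr' ?_
  filter_upwards [self_mem_nhdsWithin] with x hx
  have hx' : x ≠ 0 := ne_of_gt hx
  simp only [Function.comp, hankelH1, bJ1 x hx', bY1 x hx']
  push_cast; ring

/-! ### The antiderivative -/

noncomputable def primP (k l x : ℝ) : ℂ :=
  -((1 : ℂ) / k^2) * (1 - x / l) * hankelH1 0 (k * x)
    + (((l - x : ℝ) : ℂ) * hankelH1 1 (k * (l - x)) - (x : ℂ) * hankelH1 1 (k * x)) / (k^3 * l^2)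

lemma integrand_eq (k l x : ℝ) (hk : 0 < k) (hl : 0 < l) :
    upsAlpha k l x - upsBeta k l x - upsGamma k l x + upsDelta k l x
      = (1 - x / l : ℂ) * ((1 / k : ℂ) * hankelH1 1 (k * x)
        + (1 / (k^2 * l) : ℂ) * (hankelH1 0 (k * x) - hankelH1 0 (k * (l - x)))) := by
  have hk' : (k : ℂ) ≠ 0 := by exact_mod_cast hk.ne'
  have hl' : (l : ℂ) ≠ 0 := by exact_mod_cast hl.ne'
  simp only [upsDelta, upsGamma, upsBeta, upsAlpha]
  push_cast
  field_simp
  ring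

lemma primP_deriv (k l x : ℝ) (hk : 0 < k) (hx : 0 < x) (hxl : x < l) :
    HasDerivAt (primP k l)
      (upsAlpha k l x - upsBeta k l x - upsGamma k l x + upsDelta k l x) x := by
  have hl : 0 < l := hx.trans hxl
  have hk' : (k : ℂ) ≠ 0 := by exact_mod_cast hk.ne'
  have hl' : (l : ℂ) ≠ 0 := by exact_mod_cast hl.ne'
  have hx' : (x : ℂ) ≠ 0 := by exact_mod_cast hx.ne'
  have hlx' : (l : ℂ) - x ≠ 0 := by
    have : l - x ≠ 0 := by linarith
    exact_mod_cast this
  rw [integrand_eq k l x hk hl]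
  have d1 : HasDerivAt (fun x : ℝ => k * x) k x := by
    simpa using (hasDerivAt_id x).const_mul k
  have d2 : HasDerivAt (fun x : ℝ => l - x) (-1) x := by
    simpa using (hasDerivAt_id x).const_sub l
  have d3 : HasDerivAt (fun x : ℝ => k * (l - x)) (k * (-1)) x := d2.const_mul k
  have e0 := (hankel0_deriv (k * x) (mul_pos hk hx)).scomp x d1
  have e1 := (hankel1_deriv (k * x) (mul_pos hk hx)).scomp x d1
  have e2 := (hankel1_deriv (k * (l - x)) (mul_pos hk (sub_pos.mpr hxl))).scomp x d3
  have c1 : HasDerivAt (fun x : ℝ => (x : ℂ)) 1 x := by simpa using (hasDerivAt_id x).ofReal_comp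
  have c2 : HasDerivAt (fun x : ℝ => ((l - x : ℝ) : ℂ)) ((-1 : ℝ) : ℂ) x := d2.ofReal_comp
  have t1 := (((c1.div_const (l : ℂ)).const_sub 1).const_mul (-((1 : ℂ) / k^2))).mul e0
  have t2 := ((c2.mul e2).sub (c1.mul e1)).div_const ((k : ℂ)^3 * l^2)
  refine (t1.add t2).congr_deriv ?_
  simp only [Function.comp, Complex.real_smul]
  push_cast
  field_simp
  ring

lemma integral_eq_primP (k l ε : ℝ) (hk : 0 < k) (hε : 0 < ε) (hεl : ε < l / 2) :
    ∫ x in ε..(l - ε), (upsAlpha k l x - upsBeta k l x - upsGamma k l x + upsDelta k l x)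
      = primP k l (l - ε) - primP k l ε := by
  have hl : 0 < l := by linarith
  have hsub : ∀ x ∈ uIcc ε (l - ε), 0 < x ∧ x < l := by
    intro x hx
    rw [uIcc_of_le (by linarith)] at hx
    exact ⟨by linarith [hx.1], by linarith [hx.2]⟩
  apply intervalIntegral.integral_eq_sub_of_hasDerivAt
  · intro x hx
    exact primP_deriv k l x hk (hsub x hx).1 (hsub x hx).2
  · apply ContinuousOn.intervalIntegrable
    simp_rw [integrand_eq k l _ hk hl]
    intro x hx
    obtain ⟨h0, h1⟩ := hsub x hx
    apply ContinuousAt.continuousWithinAt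
    have a0 : ContinuousAt (fun x : ℝ => hankelH1 0 (k * x)) x :=
      ContinuousAt.comp (f := fun x : ℝ => k * x) (hankel0_deriv (k * x) (mul_pos hk h0)).continuousAt
        (by fun_prop)
    have a1 : ContinuousAt (fun x : ℝ => hankelH1 1 (k * x)) x :=
      ContinuousAt.comp (f := fun x : ℝ => k * x) (hankel1_deriv (k * x) (mul_pos hk h0)).continuousAt
        (by fun_prop)
    have a2 : ContinuousAt (fun x : ℝ => hankelH1 0 (k * (l - x))) x :=
      ContinuousAt.comp (f := fun x : ℝ => k * (l - x))
        (hankel0_deriv (k * (l - x)) (mul_pos hk (sub_pos.mpr h1))).continuousAt (by fun_prop)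
    fun_prop

/-- the limit as `ε → 0⁺` of
`(ik²/4)·∫_ε^{l−ε} (Υ_α − Υ_β − Υ_γ + Υ_δ) + (1/(2π))·log ε` is
`i/4 − (i/(2kl))·H₁⁽¹⁾(kl) − (1/(2π))·(γ_E + log(k/2)) + 1/(πk²l²)`;
in particular the logarithmic divergence of the regularized coincident hypersingular
integral is exactly `−(1/(2π))·log ε`. -/
theorem statement18 (k l : ℝ) (hk : 0 < k) (hl : 0 < l) :
    Filter.Tendsto
      (fun ε : ℝ =>
        (Complex.I * (k : ℂ) ^ 2 / 4) *
          (∫ x in ε..(l - ε),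
            (upsAlpha k l x - upsBeta k l x - upsGamma k l x + upsDelta k l x))
          + ((1 / (2 * π) * Real.log ε : ℝ) : ℂ))
      (nhdsWithin 0 (Set.Ioi 0))
      (nhds (Complex.I / 4
        - (Complex.I / (2 * (k : ℂ) * (l : ℂ))) * hankelH1 1 (k * l)
        - ((1 / (2 * π) * (Real.eulerMascheroniConstant + Real.log (k / 2)) : ℝ) : ℂ)
        + 1 / ((π : ℂ) * (k : ℂ) ^ 2 * (l : ℂ) ^ 2))) := by
  have hk' : (k : ℂ) ≠ 0 := by exact_mod_cast hk.ne'
  have hl' : (l : ℂ) ≠ 0 := by exact_mod_cast hl.ne'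
  have hpi : (π : ℂ) ≠ 0 := by exact_mod_cast Real.pi_ne_zero
  have hid : Tendsto (fun x : ℝ => x) (𝓝[>] 0) (𝓝 0) := lim_of_cont continuousAt_id
  have hidC : Tendsto (fun x : ℝ => (x : ℂ)) (𝓝[>] 0) (𝓝 0) := by
    simpa [Function.comp_def] using (Complex.continuous_ofReal.tendsto _).comp hid
  have hke : Tendsto (fun x : ℝ => k * x) (𝓝[>] 0) (𝓝[>] 0) := by
    refine tendsto_nhdsWithin_iff.mpr ⟨by simpa using hid.const_mul k, ?_⟩
    filter_upwards [self_mem_nhdsWithin] with x hx using mul_pos hk hx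
  have hle : Tendsto (fun x : ℝ => k * (l - x)) (𝓝[>] 0) (𝓝 (k * l)) := by
    simpa using (hid.const_sub l).const_mul k
  have L0 := hankel0_lim.comp hke
  have L1 := hankel1_lim.comp hke
  have M0 := ((hankel0_deriv (k * l) (mul_pos hk hl)).continuousAt.tendsto).comp hle
  have M1 := ((hankel1_deriv (k * l) (mul_pos hk hl)).continuousAt.tendsto).comp hle
  have Lx : Tendsto (fun x : ℝ => ((x * Real.log (k * x) : ℝ) : ℂ)) (𝓝[>] 0) (𝓝 0) := by
    have h1 : Tendsto (fun x : ℝ => x * Real.log x) (𝓝[>] 0) (𝓝 0) := by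
      simpa using lim_of_cont (Real.continuous_mul_log.continuousAt (x := 0))
    have h2 : Tendsto (fun x : ℝ => x * Real.log (k * x)) (𝓝[>] 0) (𝓝 0) := by
      have h3 := (hid.mul_const (Real.log k)).add h1
      simp only [zero_mul, add_zero] at h3
      refine h3.congr' ?_
      filter_upwards [self_mem_nhdsWithin] with x hx
      rw [Real.log_mul hk.ne' (ne_of_gt hx)]; ring
    simpa [Function.comp_def] using (Complex.continuous_ofReal.tendsto _).comp h2
  -- assemble the limit
  have T := (((L0.mul_const (Complex.I / 4)).sub
      ((hidC.mul L0).mul_const (Complex.I / (4 * l)))).sub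
      (Lx.mul_const (Complex.I / (4 * l) * (2 / π * Complex.I)))).sub
      ((hidC.mul M0).mul_const (Complex.I / (4 * l)))
  have T2 := ((L1.mul_const (Complex.I / (2 * k^2 * l^2))).sub
      (((hidC.const_sub (l : ℂ)).mul M1).mul_const (Complex.I / (2 * k * l^2))))
  have T3 := (T.add T2).sub
    (tendsto_const_nhds (x := ((1 / (2 * π) * Real.log k : ℝ) : ℂ)) (f := 𝓝[>] (0:ℝ)))
  refine Tendsto.congr' ?_ (Eq.mp (congrArg (fun z => Tendsto _ _ (𝓝 z)) ?_) T3)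
  · filter_upwards [Ioo_mem_nhdsGT (show (0:ℝ) < l / 2 by linarith)] with ε hε
    rw [integral_eq_primP k l ε hk hε.1 hε.2]
    simp only [primP, Function.comp, Real.log_mul hk.ne' hε.1.ne',
      show l - (l - ε) = ε by ring]
    push_cast
    field_simp
    ring_nf
    simp only [Complex.I_sq, Complex.I_pow_three]
    ring
  · rw [Real.log_div hk.ne' two_ne_zero]
    push_cast
    field_simp
    ring_nf
    simp only [Complex.I_sq, Complex.I_pow_three]
    ring
end
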